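/- Let f belong to the class S and let z ∈ 𝔻 with 0 < |z| = r < 1. Then f(z) ≠ 0 and (1−r)/(1+r) ≤ |z·f'(z)/f(z)| ≤ (1+r)/(1−r). -/

import Mathlib

open Metric MeasureTheory Set
open scoped ENNReal Real

lemma lintegral_image_of_hasDerivAt {φ φ' : ℂ → ℂ} {s : Set ℂ} (hs : MeasurableSet s)
    (h : ∀ x ∈ s, HasDerivAt φ (φ' x) x) (hinj : InjOn φ s) (g : ℂ → ℝ≥0∞) :
    ∫⁻ w in φ '' s, g w = ∫⁻ x in s, ENNReal.ofReal (‖φ' x‖ ^ 2) * g (φ x) := by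
  rw [lintegral_image_eq_lintegral_abs_det_fderiv_mul volume hs
    (fun x hx ↦ ((h x hx).hasFDerivAt.restrictScalars ℝ).hasFDerivWithinAt) hinj]
  simp [ContinuousLinearMap.det, LinearMap.det_restrictScalars,
      Algebra.norm_complex_eq, Complex.normSq_eq_norm_sq]

lemma setLIntegral_annulus_eq {s R : ℝ} (hs : 0 ≤ s) (F : ℂ → ℝ≥0∞) :
    ∫⁻ z in {z : ℂ | s < ‖z‖ ∧ ‖z‖ < R}, F z =
      ∫⁻ p in Ioo s R ×ˢ Ioo (-π) π, ENNReal.ofReal p.1 * F (circleMap 0 p.1 p.2) := by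
  have hm : MeasurableSet {z : ℂ | s < ‖z‖ ∧ ‖z‖ < R} :=
    ((isOpen_lt continuous_const continuous_norm).inter
      (isOpen_lt continuous_norm continuous_const)).measurableSet
  have hsub : Ioo s R ×ˢ Ioo (-π) π ⊆ Complex.polarCoord.target := by
    rw [Complex.polarCoord_target]
    exact prod_mono (fun x hx ↦ hs.trans_lt hx.1) subset_rfl
  rw [← lintegral_indicator hm, ← Complex.lintegral_comp_polarCoord_symm,
    ← inter_eq_self_of_subset_left hsub, ← Measure.restrict_restrict
      (measurableSet_Ioo.prod measurableSet_Ioo),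
    ← lintegral_indicator (measurableSet_Ioo.prod measurableSet_Ioo)]
  refine setLIntegral_congr_fun (measurableSet_Ioi.prod measurableSet_Ioo) fun p hp ↦ ?_
  have hp1 : 0 < p.1 := hp.1
  have hpt : Complex.polarCoord.symm p = circleMap 0 p.1 p.2 := by
    rw [Complex.polarCoord_symm_apply, circleMap, Complex.exp_mul_I]
    simp
  have hiff : p ∈ Ioo s R ×ˢ Ioo (-π) π ↔
      circleMap 0 p.1 p.2 ∈ {z : ℂ | s < ‖z‖ ∧ ‖z‖ < R} := by
    have := hp.2
    simp only [mem_prod, this, and_true, mem_ofPred_eq, norm_circleMap_zero, abs_of_pos hp1, mem_Ioo]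
  simp only [hpt, smul_eq_mul]
  by_cases h : p ∈ Ioo s R ×ˢ Ioo (-π) π
  · rw [indicator_of_mem h, indicator_of_mem (hiff.1 h)]
  · rw [indicator_of_notMem h, indicator_of_notMem (mt hiff.2 h), mul_zero]

lemma lintegral_Ioo_inv {s R : ℝ} (hs : 0 < s) (hsR : s ≤ R) :
    ∫⁻ x in Ioo s R, ENNReal.ofReal (2 * π * x⁻¹) = ENNReal.ofReal (2 * π * Real.log (R / s)) := by
  have hint : IntegrableOn (fun x : ℝ ↦ 2 * π * x⁻¹) (Ioo s R) := by
    refine (ContinuousOn.integrableOn_Icc ?_).mono_set Ioo_subset_Icc_self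
    exact continuousOn_const.mul (continuousOn_inv₀.mono fun x hx ↦ (hs.trans_le hx.1).ne')
  rw [← ofReal_integral_eq_lintegral_ofReal hint, ← integral_Ioc_eq_integral_Ioo,
    ← intervalIntegral.integral_of_le hsR, intervalIntegral.integral_const_mul,
    integral_inv_of_pos hs (hs.trans_le hsR)]
  filter_upwards [ae_restrict_mem measurableSet_Ioo] with x hx
  have := hs.trans hx.1
  simp only [Pi.zero_apply]
  positivity

lemma lintegral_annulus_inv_sq {s R : ℝ} (hs : 0 < s) (hsR : s ≤ R) :
    ∫⁻ z in {z : ℂ | s < ‖z‖ ∧ ‖z‖ < R}, ENNReal.ofReal ((‖z‖ ^ 2)⁻¹) =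
      ENNReal.ofReal (2 * π * Real.log (R / s)) := by
  rw [setLIntegral_annulus_eq hs.le, ← lintegral_Ioo_inv hs hsR, Measure.volume_eq_prod,
    ← Measure.prod_restrict, lintegral_prod _ (by
      simp only [norm_circleMap_zero]; fun_prop)]
  refine setLIntegral_congr_fun measurableSet_Ioo fun x hx ↦ ?_
  have hx0 := hs.trans hx.1
  simp only [norm_circleMap_zero, lintegral_const, Measure.restrict_apply_univ, Real.volume_Ioo]
  rw [← ENNReal.ofReal_mul hx0.le, ← ENNReal.ofReal_mul (by positivity)]
  congr 1
  rw [sq_abs]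
  field_simp
  ring

lemma le_lintegral_circle_norm_sq {G : ℂ → ℂ} (hG : DifferentiableOn ℂ G (ball 0 1))
    (hG0 : G 0 = 1) {r : ℝ} (hr0 : 0 < r) (hr : r < 1) :
    ENNReal.ofReal (2 * π) ≤
      ∫⁻ θ in Ioo (-π) π, ENNReal.ofReal (‖G (circleMap 0 r θ)‖ ^ 2) := by
  have hcont : Continuous fun θ ↦ G (circleMap 0 r θ) :=
    hG.continuousOn.comp_continuous (continuous_circleMap 0 r) fun θ ↦ by
      simpa [abs_of_pos hr0] using hr
  have hcre : Continuous fun θ ↦ (G (circleMap 0 r θ)).re := Complex.continuous_re.comp hcont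
  have hcsq : Continuous fun θ ↦ ‖G (circleMap 0 r θ)‖ ^ 2 := hcont.norm.pow 2
  have hav : ∫ θ in (-π)..π, G (circleMap 0 r θ) = 2 * π := by
    have h1 : Real.circleAverage G 0 r = 1 := by
      rw [DiffContOnCl.circleAverage, hG0]
      refine (hG.mono ?_).diffContOnCl
      rw [abs_of_pos hr0]
      exact (closure_ball_subset_closedBall).trans (closedBall_subset_ball hr)
    rw [Real.circleAverage_eq_integral_add (-π), intervalIntegral.integral_comp_add_right
      (fun θ ↦ G (circleMap 0 r θ))] at h1
    have h2 : (2 * π + -π) = π := by ring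
    have hpi : (π : ℂ) ≠ 0 := by exact_mod_cast Real.pi_ne_zero
    rw [zero_add, h2, Complex.real_smul, Complex.ofReal_inv, inv_mul_eq_one₀ (by simp [hpi])] at h1
    rw [← h1]; simp
  have hre : ∫ θ in (-π)..π, (G (circleMap 0 r θ)).re = 2 * π := by
    have := congrArg Complex.re hav
    rw [← Complex.reCLM_apply, ← Complex.reCLM.intervalIntegral_comp_comm
      (hcont.intervalIntegrable _ _)] at this
    simpa using this
  have hle : 2 * π ≤ ∫ θ in (-π)..π, ‖G (circleMap 0 r θ)‖ ^ 2 := by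
    have hpi : -π ≤ π := by linarith [Real.pi_pos]
    have := intervalIntegral.integral_mono_on (μ := volume) hpi
      (f := fun θ ↦ 2 * (G (circleMap 0 r θ)).re - 1)
      (g := fun θ ↦ ‖G (circleMap 0 r θ)‖ ^ 2)
      (((hcre.const_mul 2).sub continuous_const).intervalIntegrable _ _)
      (hcsq.intervalIntegrable _ _) (fun θ _ ↦ by
        rw [← Complex.normSq_eq_norm_sq, Complex.normSq_apply]
        nlinarith [sq_nonneg ((G (circleMap 0 r θ)).re - 1), sq_nonneg (G (circleMap 0 r θ)).im])
    rw [intervalIntegral.integral_sub ((hcre.const_mul 2).intervalIntegrable _ _) (by simp),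
      intervalIntegral.integral_const_mul, hre, intervalIntegral.integral_const, smul_eq_mul] at this
    linarith
  rw [intervalIntegral.integral_of_le (by linarith [Real.pi_pos]),
    integral_Ioc_eq_integral_Ioo] at hle
  rw [← ofReal_integral_eq_lintegral_ofReal _ (ae_of_all _ fun θ ↦ by positivity)]
  · exact ENNReal.ofReal_le_ofReal hle
  · exact hcsq.integrableOn_Icc.mono_set Ioo_subset_Icc_self

lemma le_lintegral_annulus_norm_sq {G : ℂ → ℂ} (hG : DifferentiableOn ℂ G (ball 0 1))
    (hG0 : G 0 = 1) {s R : ℝ} (hs : 0 < s) (hsR : s ≤ R) (hR : R ≤ 1) :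
    ENNReal.ofReal (2 * π * Real.log (R / s)) ≤
      ∫⁻ z in {z : ℂ | s < ‖z‖ ∧ ‖z‖ < R}, ENNReal.ofReal (‖G z / z‖ ^ 2) := by
  have hmaps : ∀ p ∈ Ioo s R ×ˢ Ioo (-π) π, circleMap 0 p.1 p.2 ∈ ball (0 : ℂ) 1 := by
    intro p hp
    simpa [abs_of_pos (hs.trans hp.1.1)] using hp.1.2.trans_le hR
  have hcm : Continuous fun p : ℝ × ℝ ↦ circleMap 0 p.1 p.2 := by
    unfold circleMap; fun_prop
  rw [setLIntegral_annulus_eq hs.le, ← lintegral_Ioo_inv hs hsR]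
  have hmeas : AEMeasurable (fun p : ℝ × ℝ ↦ ENNReal.ofReal p.1 *
      ENNReal.ofReal (‖G (circleMap 0 p.1 p.2) / circleMap 0 p.1 p.2‖ ^ 2))
      ((volume.restrict (Ioo s R)).prod (volume.restrict (Ioo (-π) π))) := by
    rw [Measure.prod_restrict]
    refine AEMeasurable.mul (by fun_prop) (ENNReal.measurable_ofReal.comp_aemeasurable ?_)
    refine AEMeasurable.pow_const (AEMeasurable.norm (AEMeasurable.div ?_ (by fun_prop))) _
    exact (hG.continuousOn.comp hcm.continuousOn hmaps).aemeasurable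
      (measurableSet_Ioo.prod measurableSet_Ioo)
  rw [Measure.volume_eq_prod, ← Measure.prod_restrict, lintegral_prod _ hmeas]
  refine setLIntegral_mono' measurableSet_Ioo fun x hx ↦ ?_
  have hx0 := hs.trans hx.1
  simp only [norm_div, norm_circleMap_zero, abs_of_pos hx0, div_pow]
  calc ENNReal.ofReal (2 * π * x⁻¹) = ENNReal.ofReal x⁻¹ * ENNReal.ofReal (2 * π) := by
        rw [mul_comm, ENNReal.ofReal_mul (by positivity)]
    _ ≤ ENNReal.ofReal x⁻¹ *
        ∫⁻ θ in Ioo (-π) π, ENNReal.ofReal (‖G (circleMap 0 x θ)‖ ^ 2) := by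
        gcongr
        exact le_lintegral_circle_norm_sq hG hG0 hx0 (hx.2.trans_le hR)
    _ = _ := by
        rw [← lintegral_const_mul' _ _ ENNReal.ofReal_ne_top]
        refine lintegral_congr fun θ ↦ ?_
        rw [← ENNReal.ofReal_mul (by positivity), ← ENNReal.ofReal_mul hx0.le]
        congr 1
        field_simp

/-- An injective Bieberbach–Eilenberg function has derivative of norm at most one at the origin. -/
lemma norm_deriv_zero_le_one_of_mul_ne_one {B : ℂ → ℂ} (hB : DifferentiableOn ℂ B (ball 0 1))
    (hinj : InjOn B (ball 0 1)) (hB0 : B 0 = 0)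
    (hmul : ∀ z ∈ ball (0 : ℂ) 1, ∀ w ∈ ball (0 : ℂ) 1, B z * B w ≠ 1) : ‖deriv B 0‖ ≤ 1 := by
  by_contra! hb
  have h0 : (0 : ℂ) ∈ ball (0 : ℂ) 1 := mem_ball_self one_pos
  set g := dslope B 0 with hgdef
  have hg : DifferentiableOn ℂ g (ball 0 1) :=
    (Complex.differentiableOn_dslope (isOpen_ball.mem_nhds h0)).2 hB
  have hg0 : g 0 = deriv B 0 := dslope_same B 0
  have hBg : ∀ z, B z = z * g z := fun z ↦ by
    simpa [hB0] using (sub_smul_dslope B 0 z).symm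
  have hB_ne : ∀ z ∈ ball (0 : ℂ) 1, z ≠ 0 → B z ≠ 0 := fun z hz hz0 h ↦
    hz0 (hinj hz h0 (h.trans hB0.symm))
  have hg_ne : ∀ z ∈ ball (0 : ℂ) 1, g z ≠ 0 := by
    intro z hz
    rcases eq_or_ne z 0 with rfl | hz0
    · rw [hg0, ← norm_pos_iff]; linarith
    · exact right_ne_zero_of_mul (hBg z ▸ hB_ne z hz hz0)
  have hBd : ∀ z ∈ ball (0 : ℂ) 1, HasDerivAt B (deriv B z) z := fun z hz ↦
    (hB.differentiableAt (isOpen_ball.mem_nhds hz)).hasDerivAt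
  set G : ℂ → ℂ := fun z ↦ 1 + z * deriv g z / g z with hGdef
  have hG : DifferentiableOn ℂ G (ball 0 1) :=
    ((differentiableOn_id.mul (hg.deriv isOpen_ball)).div hg hg_ne).const_add 1
  have hGB : ∀ z ∈ ball (0 : ℂ) 1, z ≠ 0 → deriv B z / B z = G z / z := by
    intro z hz hz0
    have h1 : HasDerivAt B (1 * g z + z * deriv g z) z := by
      have := (hasDerivAt_id z).mul (hg.differentiableAt (isOpen_ball.mem_nhds hz)).hasDerivAt
      exact this.congr_of_eventuallyEq (Filter.Eventually.of_forall hBg)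
    have := hg_ne z hz
    rw [h1.deriv, hBg z, hGdef]
    field_simp
  obtain ⟨β, hβ1, hβ⟩ := exists_between hb
  have hβ0 : 0 < β := one_pos.trans hβ1
  obtain ⟨R, hRβ, hR1⟩ := exists_between (inv_lt_one_of_one_lt₀ hβ1)
  have hR0 : 0 < R := (inv_pos.2 hβ0).trans hRβ
  have hRβ' : 1 < R * β := by rwa [inv_lt_iff_one_lt_mul₀ hβ0] at hRβ
  have hsub : closedBall (0 : ℂ) R ⊆ ball 0 1 := closedBall_subset_ball hR1
  obtain ⟨ρ, hρ0, hρ⟩ : ∃ ρ > 0, ∀ z : ℂ, ‖z‖ < ρ → β < ‖g z‖ := by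
    have hc : ContinuousAt (fun z ↦ ‖g z‖) 0 :=
      (hg.differentiableAt (isOpen_ball.mem_nhds h0)).continuousAt.norm
    have := hc.eventually_const_lt (u := β) (by simpa [hg0] using hβ)
    obtain ⟨ρ, hρ0, hρ⟩ := Metric.eventually_nhds_iff.1 this
    exact ⟨ρ, hρ0, fun z hz ↦ hρ (by simpa using hz)⟩
  obtain ⟨m, hm0, hm⟩ : ∃ m > 0, ∀ z ∈ closedBall (0 : ℂ) R, m ≤ ‖g z‖ := by
    obtain ⟨z₀, hz₀, hmin⟩ := (isCompact_closedBall (0 : ℂ) R).exists_isMinOn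
      ⟨0, mem_closedBall_self hR0.le⟩ (hg.continuousOn.mono hsub).norm
    exact ⟨‖g z₀‖, norm_pos_iff.2 (hg_ne _ (hsub hz₀)), fun z hz ↦ hmin hz⟩
  obtain ⟨M, hM⟩ := (isCompact_closedBall (0 : ℂ) R).exists_bound_of_continuousOn
    (hB.continuousOn.mono hsub)
  have hM0 : 0 ≤ M := (norm_nonneg _).trans (hM 0 (mem_closedBall_self hR0.le))
  obtain ⟨ε, hε0, hε⟩ : ∃ ε > 0, ε < min (min 1 (m * ρ)) (M + 1)⁻¹ :=
    exists_between (by positivity)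
  simp only [lt_min_iff] at hε
  obtain ⟨⟨hε1, hεm⟩, hεM⟩ := hε
  have hεM' : M < ε⁻¹ := by
    rw [lt_inv_comm₀ hε0 (by positivity)] at hεM
    linarith
  set s := ε / β with hs
  have hs0 : 0 < s := by positivity
  have hsR : s ≤ R := by
    rw [hs, div_le_iff₀ hβ0]; linarith
  set A : Set ℂ := {z : ℂ | s < ‖z‖ ∧ ‖z‖ < R} with hA
  have hAm : MeasurableSet A :=
    ((isOpen_lt continuous_const continuous_norm).inter
      (isOpen_lt continuous_norm continuous_const)).measurableSet
  have hA1 : A ⊆ ball 0 1 := fun z hz ↦ by simpa using hz.2.trans hR1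
  have hAne : ∀ z ∈ A, z ≠ 0 := fun z hz ↦ norm_pos_iff.1 (hs0.trans hz.1)
  have hBA : ∀ z ∈ A, ε < ‖B z‖ ∧ ‖B z‖ < ε⁻¹ := by
    intro z hz
    have hzR : z ∈ closedBall (0 : ℂ) R := by simpa using hz.2.le
    refine ⟨?_, (hM z hzR).trans_lt hεM'⟩
    rw [hBg, norm_mul]
    rcases lt_or_ge ‖z‖ ρ with h | h
    · have h1 : ε < ‖z‖ * β := (div_lt_iff₀ hβ0).1 hz.1
      exact h1.trans_le (by gcongr; exact (hρ z h).le)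
    · calc ε < m * ρ := hεm
        _ ≤ ‖g z‖ * ‖z‖ := by gcongr; exact hm z hzR
        _ = _ := mul_comm _ _
  set T : Set ℂ := {w : ℂ | ε < ‖w‖ ∧ ‖w‖ < ε⁻¹} with hT
  set h : ℂ → ℝ≥0∞ := fun w ↦ ENNReal.ofReal ((‖w‖ ^ 2)⁻¹) with hh
  have hB_neA : ∀ z ∈ A, B z ≠ 0 := fun z hz ↦ hB_ne z (hA1 hz) (hAne z hz)
  have hI1 : ∫⁻ w in B '' A, h w = ∫⁻ z in A, ENNReal.ofReal (‖G z / z‖ ^ 2) := by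
    rw [lintegral_image_of_hasDerivAt hAm (fun z hz ↦ hBd z (hA1 hz)) (hinj.mono hA1)]
    refine setLIntegral_congr_fun hAm fun z hz ↦ ?_
    simp only [hh]
    rw [← ENNReal.ofReal_mul (by positivity), ← hGB z (hA1 hz) (hAne z hz), norm_div, div_pow,
      div_eq_mul_inv]
  have hI2 : ∫⁻ w in (fun z ↦ (B z)⁻¹) '' A, h w =
      ∫⁻ z in A, ENNReal.ofReal (‖G z / z‖ ^ 2) := by
    rw [lintegral_image_of_hasDerivAt hAm (fun z hz ↦ (hBd z (hA1 hz)).fun_inv (hB_neA z hz))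
      (fun z hz w hw hzw ↦ hinj (hA1 hz) (hA1 hw) (inv_injective hzw))]
    refine setLIntegral_congr_fun hAm fun z hz ↦ ?_
    have := norm_ne_zero_iff.2 (hB_neA z hz)
    simp only [hh]
    rw [← ENNReal.ofReal_mul (by positivity), ← hGB z (hA1 hz) (hAne z hz)]
    simp only [norm_div, norm_neg, norm_pow, norm_inv]
    congr 1
    field_simp
  have hmeas : MeasurableSet (B '' A) :=
    measurable_image_of_fderivWithin hAm
      (fun z hz ↦ ((hBd z (hA1 hz)).hasFDerivAt.restrictScalars ℝ).hasFDerivWithinAt)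
      (hinj.mono hA1)
  have hdisj : Disjoint ((fun z ↦ (B z)⁻¹) '' A) (B '' A) := by
    rw [Set.disjoint_left]
    rintro _ ⟨z, hz, rfl⟩ ⟨w, hw, hzw⟩
    refine hmul w (hA1 hw) z (hA1 hz) ?_
    rw [hzw, inv_mul_cancel₀ (hB_neA z hz)]
  have hsubT : (fun z ↦ (B z)⁻¹) '' A ∪ B '' A ⊆ T := by
    rintro _ (⟨z, hz, rfl⟩ | ⟨z, hz, rfl⟩)
    · have := hBA z hz
      have hp : 0 < ‖B z‖ := hε0.trans this.1
      simp only [hT, mem_ofPred_eq, norm_inv]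
      exact ⟨(lt_inv_comm₀ hε0 hp).2 this.2, (inv_lt_inv₀ hp hε0).2 this.1⟩
    · exact hBA z hz
  have hεle : ε ≤ ε⁻¹ := hε1.le.trans ((one_le_inv₀ hε0).2 hε1.le)
  have hkey : ENNReal.ofReal (2 * π * Real.log (R / s)) + ENNReal.ofReal (2 * π * Real.log (R / s))
      ≤ ENNReal.ofReal (2 * π * Real.log (ε⁻¹ / ε)) := by
    have hle := le_lintegral_annulus_norm_sq hG (by simp [hGdef]) hs0 hsR hR1.le
    calc _ ≤ (∫⁻ w in (fun z ↦ (B z)⁻¹) '' A, h w) + ∫⁻ w in B '' A, h w := by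
          rw [hI1, hI2]; exact add_le_add hle hle
      _ = ∫⁻ w in (fun z ↦ (B z)⁻¹) '' A ∪ B '' A, h w := (lintegral_union hmeas hdisj).symm
      _ ≤ ∫⁻ w in T, h w := lintegral_mono_set hsubT
      _ = _ := lintegral_annulus_inv_sq hε0 hεle
  have hlog0 : 0 ≤ Real.log (R / s) := Real.log_nonneg ((one_le_div hs0).2 hsR)
  have hlog1 : 0 ≤ Real.log (ε⁻¹ / ε) := Real.log_nonneg ((one_le_div hε0).2 hεle)
  rw [← ENNReal.ofReal_add (by positivity) (by positivity),
    ENNReal.ofReal_le_ofReal_iff (by positivity)] at hkey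
  have e1 : Real.log (R / s) = Real.log (R * β) - Real.log ε := by
    rw [hs, ← Real.log_div (by positivity) hε0.ne']; congr 1; field_simp
  have e2 : Real.log (ε⁻¹ / ε) = -2 * Real.log ε := by
    rw [Real.log_div (by positivity) hε0.ne', Real.log_inv]; ring
  have e3 := Real.log_pos hRβ'
  rw [e1, e2] at hkey
  nlinarith [Real.pi_pos]

lemma exists_differentiableOn_sq_eq {g : ℂ → ℂ} (hg : DifferentiableOn ℂ g (ball 0 1))
    (hg_ne : ∀ z ∈ ball (0 : ℂ) 1, g z ≠ 0) (hg0 : g 0 = 1) :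
    ∃ h : ℂ → ℂ, DifferentiableOn ℂ h (ball 0 1) ∧ h 0 = 1 ∧
      ∀ z ∈ ball (0 : ℂ) 1, h z ^ 2 = g z := by
  obtain ⟨L, hL0, hL⟩ :=
    ((hg.deriv isOpen_ball).div hg hg_ne).isExactOn_ball.with_val_at (0 : ℂ) 0
  have hconst : ∀ z ∈ ball (0 : ℂ) 1, HasDerivAt (fun z ↦ g z * Complex.exp (-L z)) 0 z := by
    intro z hz
    have h1 := (hg.differentiableAt (isOpen_ball.mem_nhds hz)).hasDerivAt.fun_mul
      (hL z hz).fun_neg.cexp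
    convert! h1 using 1
    have := hg_ne z hz
    rw [show (deriv g / g) z = deriv g z / g z from rfl]
    field_simp
    ring
  have hL_eq : ∀ z ∈ ball (0 : ℂ) 1, g z = Complex.exp (L z) := by
    intro z hz
    have := isOpen_ball.is_const_of_deriv_eq_zero (convex_ball (0 : ℂ) 1).isPreconnected
      (fun z hz ↦ (hconst z hz).differentiableAt.differentiableWithinAt)
      (fun z hz ↦ (hconst z hz).deriv) hz (mem_ball_self one_pos)
    simp only [hL0, hg0, neg_zero, Complex.exp_zero, mul_one, Complex.exp_neg] at this
    rwa [mul_inv_eq_one₀ (Complex.exp_ne_zero _)] at this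
  refine ⟨fun z ↦ Complex.exp (L z / 2), fun z hz ↦
    ((hL z hz).div_const 2).cexp.differentiableAt.differentiableWithinAt, by simp [hL0], ?_⟩
  intro z hz
  rw [hL_eq z hz, ← Complex.exp_nat_mul]
  congr 1
  push_cast
  ring

/-- The Koebe one-quarter theorem: an omitted value has norm at least `‖deriv f 0‖ / 4`. -/
lemma norm_deriv_zero_le_four_mul {f : ℂ → ℂ} (hf : DifferentiableOn ℂ f (ball 0 1))
    (hinj : InjOn f (ball 0 1)) (hf0 : f 0 = 0) {w : ℂ} (hw : ∀ z ∈ ball (0 : ℂ) 1, f z ≠ w) :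
    ‖deriv f 0‖ ≤ 4 * ‖w‖ := by
  have h0 : (0 : ℂ) ∈ ball (0 : ℂ) 1 := mem_ball_self one_pos
  have hw0 : w ≠ 0 := fun h ↦ hw 0 h0 (hf0.trans h.symm)
  have hne : ∀ z ∈ ball (0 : ℂ) 1, 1 - f z / w ≠ 0 := by
    intro z hz h
    exact hw z hz ((div_eq_one_iff_eq hw0).1 (sub_eq_zero.1 h).symm)
  obtain ⟨h, hh, hh0, hsq⟩ := exists_differentiableOn_sq_eq (g := fun z ↦ 1 - f z / w)
    ((hf.div_const w).const_sub 1) hne (by simp [hf0])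
  have hf_eq : ∀ z ∈ ball (0 : ℂ) 1, ∀ v ∈ ball (0 : ℂ) 1, h z ^ 2 = h v ^ 2 → z = v := by
    intro z hz v hv hzv
    rw [hsq z hz, hsq v hv, sub_right_inj, div_left_inj' hw0] at hzv
    exact hinj hz hv hzv
  have hp : ∀ z ∈ ball (0 : ℂ) 1, h z + 1 ≠ 0 := by
    intro z hz hz1
    have hz1' : h z = -1 := eq_neg_of_add_eq_zero_left hz1
    obtain rfl := hf_eq z hz 0 h0 (by rw [hz1', hh0]; norm_num)
    rw [hh0] at hz1'
    norm_num at hz1'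
  have hd : HasDerivAt h (deriv h 0) 0 :=
    (hh.differentiableAt (isOpen_ball.mem_nhds h0)).hasDerivAt
  have hfd : HasDerivAt f (deriv f 0) 0 :=
    (hf.differentiableAt (isOpen_ball.mem_nhds h0)).hasDerivAt
  have hderiv : 2 * deriv h 0 = -(deriv f 0 / w) := by
    have h1 := (hd.fun_pow 2).congr_of_eventuallyEq (f₁ := fun z ↦ 1 - f z / w) (by
      filter_upwards [isOpen_ball.mem_nhds h0] with z hz using (hsq z hz).symm)
    have h2 := h1.unique ((hfd.div_const w).const_sub 1)
    simpa [hh0] using h2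
  have hBd : HasDerivAt (fun z ↦ (h z - 1) / (h z + 1)) (deriv h 0 / 2) 0 := by
    convert! (hd.sub_const 1).fun_div (hd.add_const 1) (hp 0 h0) using 1
    rw [hh0]; ring
  have hB := norm_deriv_zero_le_one_of_mul_ne_one (B := fun z ↦ (h z - 1) / (h z + 1))
    ((hh.sub_const 1).div (hh.add_const 1) hp) (by
      intro z hz v hv hzv
      simp only [div_eq_div_iff (hp z hz) (hp v hv)] at hzv
      have : h z = h v := by linear_combination hzv / 2
      exact hf_eq z hz v hv (by rw [this])) (by simp [hh0]) (by
      intro z hz v hv hzv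
      rw [div_mul_div_comm, div_eq_one_iff_eq (mul_ne_zero (hp z hz) (hp v hv))] at hzv
      have hneg : h z = - h v := by linear_combination -hzv / 2
      obtain rfl := hf_eq z hz v hv (by rw [hneg]; ring)
      have hz0 : h z = 0 := by linear_combination hneg / 2
      exact hne z hz (by rw [← hsq z hz, hz0]; norm_num))
  rw [hBd.deriv] at hB
  have hfw : deriv f 0 = -(4 * w * (deriv h 0 / 2)) := by
    have : deriv f 0 = -(2 * deriv h 0) * w := by rw [hderiv]; field_simp
    rw [this]; ring
  rw [hfw, norm_neg, norm_mul, norm_mul, Complex.norm_ofNat]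
  exact mul_le_of_le_one_right (by positivity) hB

lemma re_one_add_div_one_sub_pos {z : ℂ} (hz : ‖z‖ < 1) : 0 < ((1 + z) / (1 - z)).re := by
  have hne : 1 - z ≠ 0 := fun h ↦ by
    rw [← sub_eq_zero.1 h] at hz; simp at hz
  have hn : z.re * z.re + z.im * z.im < 1 := by
    rw [← Complex.normSq_apply, Complex.normSq_eq_norm_sq]
    nlinarith [norm_nonneg z]
  rw [Complex.div_re, ← add_div]
  refine div_pos ?_ (Complex.normSq_pos.2 hne)
  simp
  nlinarith

lemma re_exp_log_div_two_pos {w : ℂ} (hw : w ∈ Complex.slitPlane) :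
    0 < (Complex.exp (Complex.log w / 2)).re := by
  have him : (Complex.log w / 2).im = w.arg / 2 := by
    rw [show (2 : ℂ) = ((2 : ℝ) : ℂ) by norm_num, Complex.div_ofReal_im, Complex.log_im]
  rw [Complex.exp_re, him]
  refine mul_pos (Real.exp_pos _) (Real.cos_pos_of_mem_Ioo ⟨?_, ?_⟩)
  · linarith [Complex.neg_pi_lt_arg w]
  · have := (Complex.arg_le_pi w).lt_of_ne (Complex.mem_slitPlane_iff_arg.1 hw).1
    linarith

lemma norm_sub_one_div_add_one_lt_one {w : ℂ} (hw : 0 < w.re) : ‖(w - 1) / (w + 1)‖ < 1 := by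
  have hne : w + 1 ≠ 0 := fun h ↦ by
    have := congrArg Complex.re h
    simp at this
    linarith
  rw [norm_div, div_lt_one (norm_pos_iff.2 hne), ← sq_lt_sq₀ (norm_nonneg _) (norm_nonneg _),
    ← Complex.normSq_eq_norm_sq, ← Complex.normSq_eq_norm_sq, Complex.normSq_apply,
    Complex.normSq_apply]
  simp
  nlinarith

/-- The Riemann map of the unit disc with the radius `(-1, -r]` removed. -/
lemma exists_riemannMap_slit_disc {r : ℝ} (hr0 : 0 < r) (hr1 : r < 1) :
    ∃ κ : ℂ → ℂ, DifferentiableOn ℂ κ (ball 0 1) ∧ MapsTo κ (ball 0 1) (ball 0 1) ∧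
      InjOn κ (ball 0 1) ∧ κ 0 = 0 ∧ HasDerivAt κ (4 * r / (1 + r) ^ 2 : ℝ) 0 ∧
      ∀ z ∈ ball (0 : ℂ) 1, κ z ≠ -r := by
  set c : ℝ := 4 * r / (1 + r) ^ 2 with hc
  have hc0 : 0 < c := by positivity
  have hc1 : 1 - c = ((1 - r) / (1 + r)) ^ 2 := by rw [hc]; field_simp; ring
  have hc1' : 0 ≤ 1 - c := hc1 ▸ sq_nonneg _
  have h0 : (0 : ℂ) ∈ ball (0 : ℂ) 1 := mem_ball_self one_pos
  set p : ℂ → ℂ := fun z ↦ (1 + z) / (1 - z) with hp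
  have hp_re : ∀ z ∈ ball (0 : ℂ) 1, 0 < (p z).re := fun z hz ↦
    re_one_add_div_one_sub_pos (by simpa using hz)
  have hsub_ne : ∀ z ∈ ball (0 : ℂ) 1, 1 - z ≠ 0 := fun z hz h ↦ by
    have := hp_re z hz
    simp [hp, h] at this
  set Q : ℂ → ℂ := fun z ↦ (1 - c : ℝ) + c * p z ^ 2 with hQ
  have hQ_slit : ∀ z ∈ ball (0 : ℂ) 1, Q z ∈ Complex.slitPlane := by
    intro z hz
    have hre := hp_re z hz
    rw [Complex.mem_slitPlane_iff]
    by_cases him : (p z).im = 0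
    · left
      have : (Q z).re = (1 - c) + c * (p z).re ^ 2 := by simp [hQ, sq, him]
      rw [this]; positivity
    · right
      have : (Q z).im = 2 * c * (p z).re * (p z).im := by simp [hQ, sq]; ring
      rw [this]; positivity
  have hpd : ∀ z ∈ ball (0 : ℂ) 1, HasDerivAt p (2 / (1 - z) ^ 2) z := by
    intro z hz
    convert! ((hasDerivAt_id z).const_add 1).fun_div ((hasDerivAt_id z).const_sub 1)
      (hsub_ne z hz) using 1
    simp; ring
  have hQd : ∀ z ∈ ball (0 : ℂ) 1, HasDerivAt Q (c * (2 * p z * (2 / (1 - z) ^ 2))) z := by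
    intro z hz
    convert! (((hpd z hz).fun_pow 2).const_mul (c : ℂ)).const_add ((1 - c : ℝ) : ℂ) using 1
    simp
  set S : ℂ → ℂ := fun z ↦ Complex.exp (Complex.log (Q z) / 2) with hS
  have hS_sq : ∀ z ∈ ball (0 : ℂ) 1, S z ^ 2 = Q z := by
    intro z hz
    rw [hS, ← Complex.exp_nat_mul]
    simp [mul_div_cancel₀, Complex.exp_log (Complex.slitPlane_ne_zero (hQ_slit z hz))]
  have hS_re : ∀ z ∈ ball (0 : ℂ) 1, 0 < (S z).re := fun z hz ↦
    re_exp_log_div_two_pos (hQ_slit z hz)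
  have hS_ne : ∀ z ∈ ball (0 : ℂ) 1, S z + 1 ≠ 0 := fun z hz h ↦ by
    have := congrArg Complex.re h
    have := hS_re z hz
    simp at *
    linarith
  have hp0 : p 0 = 1 := by simp [hp]
  have hQ0 : Q 0 = 1 := by simp [hQ, hp0]
  have hS0 : S 0 = 1 := by simp [hS, hQ0]
  have hSd : ∀ z ∈ ball (0 : ℂ) 1,
      HasDerivAt S (S z * (c * (2 * p z * (2 / (1 - z) ^ 2)) / Q z / 2)) z := fun z hz ↦
    (((hQd z hz).clog (hQ_slit z hz)).div_const 2).cexp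
  have hκd : ∀ z ∈ ball (0 : ℂ) 1, ∀ S', HasDerivAt S S' z →
      HasDerivAt (fun z ↦ (S z - 1) / (S z + 1)) (2 * S' / (S z + 1) ^ 2) z := by
    intro z hz S' h
    convert! (h.sub_const 1).fun_div (h.add_const 1) (hS_ne z hz) using 1
    ring
  refine ⟨fun z ↦ (S z - 1) / (S z + 1), fun z hz ↦
    (hκd z hz _ (hSd z hz)).differentiableAt.differentiableWithinAt, ?_, ?_, by simp [hS0], ?_, ?_⟩
  · intro z hz
    simpa using norm_sub_one_div_add_one_lt_one (hS_re z hz)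
  · intro z hz w hw hzw
    simp only [div_eq_div_iff (hS_ne z hz) (hS_ne w hw)] at hzw
    have hSS : S z = S w := by linear_combination hzw / 2
    have hQQ : Q z = Q w := by rw [← hS_sq z hz, ← hS_sq w hw, hSS]
    have hpp : p z ^ 2 = p w ^ 2 := by
      simpa [hQ, hc0.ne'] using hQQ
    rcases sq_eq_sq_iff_eq_or_eq_neg.1 hpp with h | h
    · rw [hp] at h
      simp only [div_eq_div_iff (hsub_ne z hz) (hsub_ne w hw)] at h
      linear_combination h / 2
    · have h1 := hp_re z hz
      have h2 := hp_re w hw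
      rw [h, Complex.neg_re] at h1
      linarith
  · convert! hκd 0 h0 _ (hSd 0 h0) using 1
    rw [hS0, hQ0, hp0]
    ring
  · intro z hz h
    have hr1' : (1 + r : ℂ) ≠ 0 := by exact_mod_cast (by positivity : 1 + r ≠ 0)
    rw [div_eq_iff (hS_ne z hz)] at h
    have hSz : S z = (1 - r) / (1 + r) := by
      rw [eq_div_iff hr1']; linear_combination h
    have h1 := hS_sq z hz
    simp only [hSz, hQ, hc1] at h1
    push_cast at h1
    have h2 : (c : ℂ) * p z ^ 2 = 0 := by linear_combination -h1
    have h3 : p z = 0 := by simpa [hc0.ne'] using h2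
    have := hp_re z hz
    simp [h3] at this

/-- The lower bound of the Koebe growth theorem. -/
lemma growth_lower {f : ℂ → ℂ} (hf : DifferentiableOn ℂ f (ball 0 1))
    (hinj : InjOn f (ball 0 1)) (hf0 : f 0 = 0) {z : ℂ} (hz0 : z ≠ 0) (hz : ‖z‖ < 1) :
    ‖deriv f 0‖ * ‖z‖ ≤ ‖f z‖ * (1 + ‖z‖) ^ 2 := by
  have hr0 : 0 < ‖z‖ := norm_pos_iff.2 hz0
  have h0 : (0 : ℂ) ∈ ball (0 : ℂ) 1 := mem_ball_self one_pos
  obtain ⟨κ, hκ, hmaps, hκinj, hκ0, hκd, hκne⟩ := exists_riemannMap_slit_disc hr0 hz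
  set u : ℂ := -(z / ‖z‖) with hu
  have hr0' : (‖z‖ : ℂ) ≠ 0 := by exact_mod_cast hr0.ne'
  have hu1 : ‖u‖ = 1 := by simp [hu, hr0.ne']
  have hu0 : u ≠ 0 := norm_ne_zero_iff.1 (by rw [hu1]; exact one_ne_zero)
  have hmaps' : MapsTo (fun ζ ↦ u * κ ζ) (ball 0 1) (ball 0 1) := by
    intro ζ hζ
    simpa [hu1] using hmaps hζ
  have hd : HasDerivAt (fun ζ ↦ f (u * κ ζ))
      (deriv f 0 * (u * (4 * ‖z‖ / (1 + ‖z‖) ^ 2 : ℝ))) 0 := by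
    have h1 : HasDerivAt f (deriv f 0) (u * κ 0) := by
      rw [hκ0, mul_zero]
      exact (hf.differentiableAt (isOpen_ball.mem_nhds h0)).hasDerivAt
    exact h1.comp 0 (hκd.const_mul u)
  have := norm_deriv_zero_le_four_mul (f := fun ζ ↦ f (u * κ ζ)) (w := f z)
    (hf.comp (hκ.const_mul u) hmaps')
    (hinj.comp (fun a ha b hb hab ↦ hκinj ha hb (mul_left_cancel₀ hu0 hab)) hmaps')
    (by simp [hκ0, hf0]) (by
      intro ζ hζ h
      refine hκne ζ hζ (mul_left_cancel₀ hu0 ?_)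
      have h1 : u * κ ζ = z := hinj (hmaps' hζ) (by simpa using hz) h
      rw [h1, hu]
      field_simp)
  rw [hd.deriv, norm_mul, norm_mul, hu1, one_mul, Complex.norm_real,
    Real.norm_of_nonneg (by positivity), mul_div_assoc', div_le_iff₀ (by positivity)] at this
  linarith

/-- The Koebe transform of a univalent function. -/
lemma exists_koebe_transform {f : ℂ → ℂ} (hf : DifferentiableOn ℂ f (ball 0 1))
    (hinj : InjOn f (ball 0 1)) (hf0 : f 0 = 0) {z : ℂ} (hz : ‖z‖ < 1) :
    ∃ F : ℂ → ℂ, DifferentiableOn ℂ F (ball 0 1) ∧ InjOn F (ball 0 1) ∧ F 0 = 0 ∧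
      ‖deriv F 0‖ = (1 - ‖z‖ ^ 2) * ‖deriv f z‖ ∧ ‖F (-z)‖ = ‖f z‖ := by
  set q : ℂ := starRingEnd ℂ z with hq
  have hzq : z * q = (‖z‖ ^ 2 : ℝ) := by
    rw [hq, Complex.mul_conj, Complex.normSq_eq_norm_sq]
  have hz2 : 0 < 1 - ‖z‖ ^ 2 := by nlinarith [norm_nonneg z]
  have h0 : (0 : ℂ) ∈ ball (0 : ℂ) 1 := mem_ball_self one_pos
  have hlt : ∀ w : ℂ, ‖w‖ < 1 → ‖w + z‖ < ‖1 + q * w‖ := by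
    intro w hw
    have hw2 : 0 < 1 - ‖w‖ ^ 2 := by nlinarith [norm_nonneg w]
    have := mul_pos hz2 hw2
    rw [← sq_lt_sq₀ (norm_nonneg _) (norm_nonneg _)]
    simp only [← Complex.normSq_eq_norm_sq, Complex.normSq_apply] at this ⊢
    simp [hq]
    nlinarith
  have hne : ∀ w ∈ ball (0 : ℂ) 1, 1 + q * w ≠ 0 := fun w hw ↦
    norm_pos_iff.1 ((norm_nonneg _).trans_lt (hlt w (by simpa using hw)))
  set φ : ℂ → ℂ := fun w ↦ (w + z) / (1 + q * w) with hφ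
  have hmaps : MapsTo φ (ball 0 1) (ball 0 1) := by
    intro w hw
    rw [mem_ball_zero_iff, hφ, norm_div, div_lt_one (norm_pos_iff.2 (hne w hw))]
    exact hlt w (by simpa using hw)
  have hφinj : InjOn φ (ball 0 1) := by
    intro a ha b hb hab
    simp only [hφ, div_eq_div_iff (hne a ha) (hne b hb)] at hab
    have h1 : (1 - z * q) * (a - b) = 0 := by linear_combination hab
    have h2 : 1 - z * q ≠ 0 := by rw [hzq]; exact_mod_cast hz2.ne'
    exact sub_eq_zero.1 ((mul_eq_zero.1 h1).resolve_left h2)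
  have hφdiff : DifferentiableOn ℂ φ (ball 0 1) :=
    (differentiableOn_id.add_const z).div ((differentiableOn_id.const_mul q).const_add 1) hne
  have hφ0 : φ 0 = z := by simp [hφ]
  have hφd : HasDerivAt φ (1 - ‖z‖ ^ 2 : ℝ) 0 := by
    convert! ((hasDerivAt_id (0 : ℂ)).add_const z).fun_div
      (((hasDerivAt_id (0 : ℂ)).const_mul q).const_add 1) (hne 0 h0) using 1
    simp only [Complex.ofReal_sub, ← hzq]
    simp
  have hFd : HasDerivAt (fun w ↦ f (φ w) - f z) (deriv f z * (1 - ‖z‖ ^ 2 : ℝ)) 0 := by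
    have h1 : HasDerivAt f (deriv f z) (φ 0) := by
      rw [hφ0]
      exact (hf.differentiableAt (isOpen_ball.mem_nhds (by simpa using hz))).hasDerivAt
    exact (h1.comp 0 hφd).sub_const _
  refine ⟨fun w ↦ f (φ w) - f z, (hf.comp hφdiff hmaps).sub_const _, ?_, by simp [hφ0], ?_, ?_⟩
  · intro a ha b hb hab
    exact hφinj ha hb (hinj (hmaps ha) (hmaps hb) (sub_left_injective hab))
  · rw [hFd.deriv, norm_mul, Complex.norm_real, Real.norm_of_nonneg hz2.le, mul_comm]
  · simp [hφ, hf0]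

lemma norm_deriv_mul_le {f : ℂ → ℂ} (hf : DifferentiableOn ℂ f (ball 0 1))
    (hinj : InjOn f (ball 0 1)) (hf0 : f 0 = 0) {z : ℂ} (hz0 : z ≠ 0) (hz : ‖z‖ < 1) :
    ‖deriv f z‖ * (‖z‖ * (1 - ‖z‖)) ≤ ‖f z‖ * (1 + ‖z‖) := by
  obtain ⟨F, hF, hFinj, hF0, hF1, hFz⟩ := exists_koebe_transform hf hinj hf0 hz
  have := growth_lower hF hFinj hF0 (neg_ne_zero.2 hz0) (by simpa using hz)
  rw [hF1, hFz, norm_neg] at this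
  have hpos : 0 < 1 + ‖z‖ := by positivity
  refine le_of_mul_le_mul_right ?_ hpos
  linarith

/-- The upper bound of the Koebe growth theorem. -/
lemma growth_upper {f : ℂ → ℂ} (hf : DifferentiableOn ℂ f (ball 0 1))
    (hinj : InjOn f (ball 0 1)) (hf0 : f 0 = 0) {z : ℂ} (hz0 : z ≠ 0) (hz : ‖z‖ < 1) :
    ‖f z‖ * (1 - ‖z‖) ^ 2 ≤ ‖deriv f 0‖ * ‖z‖ := by
  have hr0 : 0 < ‖z‖ := norm_pos_iff.2 hz0
  have hr0' : (‖z‖ : ℂ) ≠ 0 := by exact_mod_cast hr0.ne'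
  have h0 : (0 : ℂ) ∈ ball (0 : ℂ) 1 := mem_ball_self one_pos
  set u : ℂ := z / ‖z‖ with hu
  have hu1 : ‖u‖ = 1 := by simp [hu, hr0.ne']
  have hzu : ‖z‖ * u = z := by rw [hu]; field_simp
  set g := dslope f 0 with hgdef
  have hg : DifferentiableOn ℂ g (ball 0 1) :=
    (Complex.differentiableOn_dslope (isOpen_ball.mem_nhds h0)).2 hf
  have hfg : ∀ z, f z = z * g z := fun z ↦ by
    simpa [hf0] using (sub_smul_dslope f 0 z).symm
  have hnorm : ∀ t : ℝ, 0 ≤ t → ‖t * u‖ = t := fun t ht ↦ by simp [hu1, abs_of_nonneg ht]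
  set N : ℝ → ℝ := fun t ↦ ‖g (t * u)‖ ^ 2 * (1 - t) ^ 4 with hN
  have hNcont : ContinuousOn N (Ico 0 1) := by
    refine ContinuousOn.mul (ContinuousOn.pow (ContinuousOn.norm ?_) 2) (by fun_prop)
    refine hg.continuousOn.comp (by fun_prop) fun t ht ↦ ?_
    rw [mem_ball_zero_iff, hnorm t ht.1]
    exact ht.2
  have hNd : ∀ t ∈ Ioo (0 : ℝ) 1, HasDerivAt N
      ((2 * inner ℝ (f (t * u)) (deriv f (t * u) * u) * (t * (1 - t)) -
        ‖f (t * u)‖ ^ 2 * (2 * (1 + t))) * ((1 - t) ^ 3 / t ^ 3)) t := by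
    intro t ht
    have hmem : (t : ℂ) * u ∈ ball (0 : ℂ) 1 := by
      rw [mem_ball_zero_iff, hnorm t ht.1.le]
      exact ht.2
    have h1 : HasDerivAt (fun s : ℝ ↦ f (s * u)) (deriv f (t * u) * u) t := by
      have h2 : HasDerivAt (fun s : ℝ ↦ (s : ℂ) * u) u t := by
        simpa using (Complex.ofRealCLM.hasDerivAt (x := t)).mul_const u
      exact (hf.differentiableAt (isOpen_ball.mem_nhds hmem)).hasDerivAt.comp t h2
    have ht0 := ht.1.ne'
    have h3 := (h1.norm_sq.fun_mul (((hasDerivAt_id t).const_sub 1).fun_pow 4)).fun_div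
      (hasDerivAt_pow 2 t) (pow_ne_zero 2 ht0)
    have h4 := h3.congr_of_eventuallyEq (f₁ := N) (by
      filter_upwards [isOpen_Ioi.mem_nhds ht.1] with s hs
      have hs0 : 0 < s := hs
      rw [hfg, norm_mul, hnorm s hs0.le, hN]
      simp only [id]
      field_simp)
    convert! h4 using 1
    simp only [id]
    field_simp
    ring
  have hanti : AntitoneOn N (Ico 0 1) := by
    refine antitoneOn_of_deriv_nonpos (convex_Ico 0 1) hNcont ?_ ?_ <;> rw [interior_Ico]
    · exact fun t ht ↦ (hNd t ht).differentiableAt.differentiableWithinAt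
    · intro t ht
      rw [(hNd t ht).deriv]
      have ht1 : 0 < 1 - t := sub_pos.2 ht.2
      have ht0 : 0 < t := ht.1
      refine mul_nonpos_of_nonpos_of_nonneg ?_ (by positivity)
      have hne : (t : ℂ) * u ≠ 0 := norm_ne_zero_iff.1 (by rw [hnorm t ht0.le]; exact ht0.ne')
      have h5 := norm_deriv_mul_le hf hinj hf0 hne (by rw [hnorm t ht0.le]; exact ht.2)
      rw [hnorm t ht0.le] at h5
      have h6 := real_inner_le_norm (f (t * u)) (deriv f (t * u) * u)
      rw [norm_mul, hu1, mul_one] at h6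
      have h7 := mul_le_mul_of_nonneg_right h6 (mul_pos ht0 ht1).le
      have h8 := mul_le_mul_of_nonneg_left h5 (norm_nonneg (f (t * u)))
      nlinarith
  have hle := hanti ⟨le_rfl, one_pos⟩ ⟨hr0.le, hz⟩ hr0.le
  simp only [hN, hzu, Complex.ofReal_zero, zero_mul, sub_zero, one_pow, mul_one] at hle
  have hg0 : g 0 = deriv f 0 := dslope_same f 0
  rw [hg0, show ‖g z‖ ^ 2 * (1 - ‖z‖) ^ 4 = (‖g z‖ * (1 - ‖z‖) ^ 2) ^ 2 by ring] at hle
  have hle' := (sq_le_sq₀ (by positivity) (norm_nonneg _)).1 hle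
  rw [hfg z, norm_mul]
  nlinarith

/-- For `f` in the class `S` and `0 < |z| = r < 1`, `f z ≠ 0` and
`(1-r)/(1+r) ≤ |z f'(z)/f(z)| ≤ (1+r)/(1-r)`. -/
theorem class_S_log_derivative_bound (f : ℂ → ℂ)
    (hf : DifferentiableOn ℂ f (ball (0 : ℂ) 1))
    (hinj : Set.InjOn f (ball (0 : ℂ) 1))
    (hf0 : f 0 = 0) (hf1 : deriv f 0 = 1)
    (z : ℂ) (r : ℝ) (hz : ‖z‖ = r) (hr0 : 0 < r) (hr : r < 1) :
    f z ≠ 0 ∧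
      (1 - r) / (1 + r) ≤ ‖z * deriv f z / f z‖ ∧
      ‖z * deriv f z / f z‖ ≤ (1 + r) / (1 - r) := by
  subst hz
  have hz0 : z ≠ 0 := norm_pos_iff.1 hr0
  have hfz : f z ≠ 0 := fun h ↦
    hz0 (hinj (by simpa using hr) (mem_ball_self one_pos) (h.trans hf0.symm))
  have hfz' : 0 < ‖f z‖ := norm_pos_iff.2 hfz
  have hr1 : 0 < 1 - ‖z‖ := sub_pos.2 hr
  refine ⟨hfz, ?_, ?_⟩
  · obtain ⟨F, hF, hFinj, hF0, hF1, hFz⟩ := exists_koebe_transform hf hinj hf0 hr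
    have := growth_upper hF hFinj hF0 (neg_ne_zero.2 hz0) (by simpa using hr)
    rw [hF1, hFz, norm_neg] at this
    rw [norm_div, norm_mul, div_le_div_iff₀ (by positivity) hfz']
    refine le_of_mul_le_mul_right ?_ hr1
    linarith
  · rw [norm_div, norm_mul, div_le_div_iff₀ hfz' hr1]
    linarith [norm_deriv_mul_le hf hinj hf0 hz0 hr]
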